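/- arXiv:1408.0937 — 2 statements merged into one kernel-verified Lean document; each statement's English description precedes it below -/
import Mathlib

section
/- The quadratic L-function functional equation for odd conductor degree: if g ∈ F_q[t] is monic squarefree of odd degree, then L(x, χ_g) = (q^(1/2) x)^(deg g - 1) · L(1/(qx), χ_g), where L(x, χ_g) = Σ_{f monic} (f/g) x^(deg f) is a polynomial. Equivalently, writing L(x,χ_g) = Σ_d c_d x^d, one has c_{deg g - 1 - d} = q^{(deg g - 1)/2 - d} c_d for all 0 ≤ d ≤ deg g - 1. -/
open scoped Classical

/-- The quadratic residue (Legendre) symbol `(f/p)` for `p` a prime (irreducible) polynomial. -/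
noncomputable def legendrePoly {F : Type} [Field F] (f p : Polynomial F) : ℤ :=
  if p ∣ f then 0 else if ∃ h : Polynomial F, p ∣ (h ^ 2 - f) then 1 else -1

/-- The quadratic residue symbol `(f/g)`, extended multiplicatively in `g`. -/
noncomputable def resSym {F : Type} [Field F] (f g : Polynomial F) : ℤ :=
  ((UniqueFactorizationMonoid.normalizedFactors g).map (fun p => legendrePoly f p)).prod

/-- The monic polynomial `X^d + Σ_i c_i X^i`. -/
noncomputable def monicOf {F : Type} [Field F] (d : ℕ) (c : Fin d → F) : Polynomial F :=
  Polynomial.X ^ d + ∑ i : Fin d, Polynomial.C (c i) * Polynomial.X ^ (i : ℕ)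

/-- The `d`-th coefficient of `L(x, χ_g)`: the sum of `(f/g)` over monic `f` of degree `d`. -/
noncomputable def Lcoeff (F : Type) [Field F] [Fintype F] (g : Polynomial F) (d : ℕ) : ℤ :=
  ∑ c : Fin d → F, resSym (monicOf d c) g

open Polynomial

/-- quadratic character with complex values -/
noncomputable def etaC (K : Type) [Field K] [Fintype K] : MulChar K ℂ :=
  (quadraticChar K).ringHomComp (Int.castRingHom ℂ)

lemma etaC_apply (K : Type) [Field K] [Fintype K] (x : K) :
    etaC K x = ((quadraticChar K x : ℤ) : ℂ) := rfl

lemma sum_etaC {K : Type} [Field K] [Fintype K] (hK : ringChar K ≠ 2) :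
    ∑ x : K, etaC K x = 0 := by
  simp only [etaC_apply]
  rw [← Int.cast_sum, quadraticChar_sum_zero hK, Int.cast_zero]

lemma sum_sq {K : Type} [Field K] [Fintype K] (hK : ringChar K ≠ 2) (ψ : AddChar K ℂ)
    (hψ : ψ ≠ 1) : ∑ x : K, ψ (x ^ 2) = ∑ x : K, etaC K x * ψ x := by
  have h0 : ∑ x : K, ψ x = 0 := AddChar.sum_eq_zero_iff_ne_zero.2 hψ
  have h1 : ∑ x : K, ψ (x ^ 2) = ∑ y : K, (etaC K y + 1) * ψ y := by
    rw [← Finset.sum_fiberwise (s := Finset.univ) (g := fun x : K => x ^ 2)]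
    refine Finset.sum_congr rfl fun y _ => ?_
    have h2 := quadraticChar_card_sqrts hK y
    rw [etaC_apply]
    have h3 : ((quadraticChar K y : ℤ) : ℂ) + 1
        = ((Finset.univ.filter fun x : K => x ^ 2 = y).card : ℂ) := by
      rw [← Int.cast_one, ← Int.cast_add, ← h2]
      simp only [Int.cast_natCast]
      congr 2
      ext x
      simp
    rw [h3, Finset.sum_congr rfl (g := fun _ => ψ y)]
    · simp
    · intro x hx
      simp only [Finset.mem_filter, Finset.mem_univ, true_and] at hx
      rw [hx]
  rw [h1]
  simp [add_mul, Finset.sum_add_distrib, h0]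

lemma field_gauss {K : Type} [Field K] [Fintype K] (hK : ringChar K ≠ 2) (ψ : AddChar K ℂ)
    (hψ : ψ ≠ 1) (b : K) :
    ∑ x : K, etaC K x * ψ (x * b) = etaC K b * ∑ x : K, ψ (x ^ 2) := by
  rw [sum_sq hK ψ hψ]
  by_cases hb : b = 0
  · subst hb
    rw [(etaC K).map_zero]
    simp [sum_etaC hK]
  · have h := gaussSum_mulShift (etaC K) ψ (Units.mk0 b hb)
    simp only [gaussSum, AddChar.mulShift_apply, Units.val_mk0] at h
    rw [← h, ← mul_assoc, ← map_mul]
    have : etaC K (b * b) = 1 := by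
      rw [etaC_apply, ← pow_two, quadraticChar_sq_one' hb, Int.cast_one]
    rw [this, one_mul]
    exact Finset.sum_congr rfl fun x _ => by rw [mul_comm b]

lemma sum_sq_ne_zero {K : Type} [Field K] [Fintype K] (hK : ringChar K ≠ 2) (ψ : AddChar K ℂ)
    (hψ : ψ ≠ 1) : ∑ x : K, ψ (x ^ 2) ≠ 0 := by
  rw [sum_sq hK ψ hψ]
  intro h
  have hne : etaC K ≠ 1 := by
    intro h1
    obtain ⟨a, ha⟩ := quadraticChar_exists_neg_one hK
    have h2 : etaC K a = -1 := by rw [etaC_apply, ha]; simp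
    have h0 : IsUnit a := by
      rw [isUnit_iff_ne_zero]; rintro rfl; simp at ha
    rw [h1, MulChar.one_apply h0] at h2
    norm_num at h2
  have := gaussSum_sq hne ((quadraticChar_isQuadratic K).comp _) (AddChar.IsPrimitive.of_ne_one hψ)
  rw [gaussSum, h, etaC_apply] at this
  have h3 := quadraticChar_sq_one (F := K) (a := -1) (by simp)
  have h4 : (quadraticChar K (-1) : ℤ) ≠ 0 := by
    intro h5; rw [h5] at h3; simp at h3
  have h6 : ((quadraticChar K (-1) : ℤ) : ℂ) ≠ 0 := by exact_mod_cast h4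
  have h7 : (Fintype.card K : ℂ) ≠ 0 := by exact_mod_cast Fintype.card_ne_zero
  exact mul_ne_zero h6 h7 (by rw [← this]; simp)

lemma addChar_pi {ι : Type} [Fintype ι] {K : ι → Type} [∀ i, Field (K i)]
    (Ψ : AddChar (∀ i, K i) ℂ) (a : ∀ i, K i) : Ψ a = ∏ i, Ψ (Pi.single i (a i)) := by
  conv_lhs => rw [← Finset.univ_sum_single a]
  exact map_sum Ψ.toAddMonoidHom _ _

/-- component of an additive character -/
noncomputable def compChar {ι : Type} {K : ι → Type} [∀ i, Field (K i)]
    (Ψ : AddChar (∀ i, K i) ℂ) (i : ι) : AddChar (K i) ℂ :=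
  Ψ.compAddMonoidHom (AddMonoidHom.single K i)

lemma pi_gauss {ι : Type} [Fintype ι] {K : ι → Type} [∀ i, Field (K i)] [∀ i, Fintype (K i)]
    (hK : ∀ i, ringChar (K i) ≠ 2) (Ψ : AddChar (∀ i, K i) ℂ)
    (hΨ : ∀ i, ∃ x, Ψ (Pi.single i x) ≠ 1) (b : ∀ i, K i) :
    ∑ a : ∀ i, K i, (∏ i, etaC (K i) (a i)) * Ψ (a * b)
      = (∏ i, etaC (K i) (b i)) * ∑ a : ∀ i, K i, Ψ (a ^ 2) := by
  have hc : ∀ a, Ψ a = ∏ i, compChar Ψ i (a i) := fun a => addChar_pi Ψ a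
  have hn : ∀ i, compChar Ψ i ≠ 1 := by
    intro i h
    obtain ⟨x, hx⟩ := hΨ i
    apply hx
    have : compChar Ψ i x = 1 := by rw [h]; rfl
    exact this
  have h1 : ∑ a : ∀ i, K i, (∏ i, etaC (K i) (a i)) * Ψ (a * b)
      = ∏ i, ∑ x : K i, etaC (K i) x * compChar Ψ i (x * b i) := by
    rw [Finset.prod_univ_sum, Fintype.piFinset_univ]
    refine Finset.sum_congr rfl fun a _ => ?_
    rw [hc, ← Finset.prod_mul_distrib]
    rfl
  have h2 : ∑ a : ∀ i, K i, Ψ (a ^ 2) = ∏ i, ∑ x : K i, compChar Ψ i (x ^ 2) := by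
    rw [Finset.prod_univ_sum, Fintype.piFinset_univ]
    refine Finset.sum_congr rfl fun a _ => ?_
    rw [hc]
    rfl
  rw [h1, h2, ← Finset.prod_mul_distrib]
  exact Finset.prod_congr rfl fun i _ => field_gauss (hK i) _ (hn i) (b i)

/-- polynomial with prescribed low coefficients -/
noncomputable def pol {F : Type} [Field F] (k : ℕ) (y : Fin k → F) : F[X] :=
  ∑ i : Fin k, C (y i) * X ^ (i : ℕ)

/-- top coefficient functional on `F[X]/(g)` -/
noncomputable def lam {F : Type} [Field F] {g : F[X]} (hg : g.Monic) : AdjoinRoot g →ₗ[F] F :=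
  (lcoeff F (g.natDegree - 1)).comp (AdjoinRoot.modByMonicHom hg)

section
variable {F : Type} [Field F] {g : F[X]}

lemma degree_pol_lt (k : ℕ) (y : Fin k → F) : (pol k y).degree < k := by
  unfold pol
  refine (degree_sum_fin_lt y)

lemma coeff_pol (k : ℕ) (y : Fin k → F) (i : Fin k) : (pol k y).coeff i = y i := by
  simp [pol, coeff_C_mul, coeff_X_pow, Fin.val_inj]

lemma coeff_pol_self (k : ℕ) (y : Fin k → F) : (pol k y).coeff k = 0 :=
  coeff_eq_zero_of_degree_lt (degree_pol_lt k y)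

lemma red_mk (hg : g.Monic) {P : F[X]} (hP : P.degree < g.natDegree) :
    AdjoinRoot.modByMonicHom hg (AdjoinRoot.mk g P) = P := by
  rw [AdjoinRoot.modByMonicHom_mk, modByMonic_eq_self_iff hg, degree_eq_natDegree hg.ne_zero]
  exact hP

lemma mk_red (hg : g.Monic) (a : AdjoinRoot g) :
    AdjoinRoot.mk g (AdjoinRoot.modByMonicHom hg a) = a := AdjoinRoot.mk_leftInverse hg a

lemma degree_red_lt (hg : g.Monic) (a : AdjoinRoot g) :
    (AdjoinRoot.modByMonicHom hg a).degree < g.natDegree := by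
  rw [← mk_red hg a, AdjoinRoot.modByMonicHom_mk, ← degree_eq_natDegree hg.ne_zero]
  exact degree_modByMonic_lt _ hg

lemma lam_mk (hg : g.Monic) {P : F[X]} (hP : P.degree < g.natDegree) :
    lam hg (AdjoinRoot.mk g P) = P.coeff (g.natDegree - 1) := by
  simp [lam, red_mk hg hP]

lemma lam_shift_ne (hg : g.Monic) (a : AdjoinRoot g) (ha : AdjoinRoot.modByMonicHom hg a ≠ 0) :
    lam hg (a * AdjoinRoot.mk g
      (X ^ (g.natDegree - 1 - (AdjoinRoot.modByMonicHom hg a).natDegree))) ≠ 0 := by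
  have h1 := degree_red_lt hg a
  set P := AdjoinRoot.modByMonicHom hg a with hP
  have h2 : P.natDegree < g.natDegree := (natDegree_lt_iff_degree_lt ha).2 h1
  have h3 : a = AdjoinRoot.mk g P := (mk_red hg a).symm
  rw [h3, ← map_mul, lam_mk]
  · have : g.natDegree - 1 = P.natDegree + (g.natDegree - 1 - P.natDegree) := by omega
    conv_lhs => rw [this]
    rw [show P.natDegree + (g.natDegree - 1 - P.natDegree) - P.natDegree
      = g.natDegree - 1 - P.natDegree by omega, coeff_mul_X_pow]
    simpa using ha
  · rw [degree_mul, degree_X_pow, degree_eq_natDegree ha]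
    norm_cast
    omega

lemma lam_shift (hg : g.Monic) (a : AdjoinRoot g) (d k : ℕ) (hn : d + k + 1 = g.natDegree) :
    (∀ i : Fin d, lam hg (a * AdjoinRoot.mk g (X ^ (i : ℕ))) = 0) ↔
      (AdjoinRoot.modByMonicHom hg a).degree < (k + 1 : ℕ) := by
  have h1 := degree_red_lt hg a
  constructor
  · intro h
    by_contra hlt
    have ha : AdjoinRoot.modByMonicHom hg a ≠ 0 := by
      intro h0; rw [h0, degree_zero] at hlt; exact hlt (WithBot.bot_lt_coe _)
    have h2 := (natDegree_lt_iff_degree_lt ha).2 h1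
    have h3 : ¬ (AdjoinRoot.modByMonicHom hg a).natDegree < k + 1 := fun h4 =>
      hlt ((natDegree_lt_iff_degree_lt ha).1 h4)
    exact lam_shift_ne hg a ha
      (h ⟨g.natDegree - 1 - (AdjoinRoot.modByMonicHom hg a).natDegree, by omega⟩)
  · intro h i
    set P := AdjoinRoot.modByMonicHom hg a with hP
    have h3 : a = AdjoinRoot.mk g P := (mk_red hg a).symm
    have h4 : (P * X ^ (i : ℕ)).degree < ((g.natDegree - 1 : ℕ) : WithBot ℕ) := by
      by_cases h0 : P = 0
      · rw [h0, zero_mul, degree_zero]; exact WithBot.bot_lt_coe _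
      · have := (natDegree_lt_iff_degree_lt h0).2 h
        rw [degree_mul, degree_X_pow, degree_eq_natDegree h0]
        norm_cast
        omega
    rw [h3, ← map_mul, lam_mk]
    · exact coeff_eq_zero_of_degree_lt h4
    · exact h4.trans_le (by norm_cast; omega)

lemma lam_pol (hg : g.Monic) (a : AdjoinRoot g) (d : ℕ) (c : Fin d → F) :
    lam hg (a * AdjoinRoot.mk g (pol d c))
      = ∑ i, c i * lam hg (a * AdjoinRoot.mk g (X ^ (i : ℕ))) := by
  rw [pol, map_sum, Finset.mul_sum, map_sum]
  refine Finset.sum_congr rfl fun i _ => ?_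
  rw [← smul_eq_C_mul, ← AdjoinRoot.smul_mk, mul_smul_comm, map_smul, smul_eq_mul]

lemma sum_psi_pi [Fintype F] (ψ : AddChar F ℂ) (hψ : ψ ≠ 1) (d : ℕ) (v : Fin d → F) :
    ∑ c : Fin d → F, ψ (∑ i, c i * v i)
      = if ∀ i, v i = 0 then (Fintype.card F : ℂ) ^ d else 0 := by
  have h1 : ∀ c : Fin d → F, ψ (∑ i, c i * v i) = ∏ i, ψ (c i * v i) := fun c =>
    map_sum ψ.toAddMonoidHom _ _
  simp only [h1]
  have := Finset.prod_univ_sum (fun _ : Fin d => (Finset.univ : Finset F))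
    (fun i x => ψ (x * v i))
  rw [Fintype.piFinset_univ] at this
  rw [← this]
  simp only [AddChar.sum_mulShift _ (AddChar.IsPrimitive.of_ne_one hψ)]
  split_ifs with h
  · simp [h]
  · push Not at h
    obtain ⟨i, hi⟩ := h
    exact Finset.prod_eq_zero (Finset.mem_univ i) (by simp [hi])

lemma sum_trunc [Fintype F] [Fintype (AdjoinRoot g)] (hg : g.Monic) (k : ℕ)
    (hk : k + 1 ≤ g.natDegree) (H : AdjoinRoot g → ℂ) :
    ∑ a, (if (AdjoinRoot.modByMonicHom hg a).degree < (k + 1 : ℕ) then H a else 0)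
      = ∑ c : F, ∑ y : Fin k → F, H (AdjoinRoot.mk g (C c * X ^ k + pol k y)) := by
  have hdeg : ∀ (c : F) (y : Fin k → F), (C c * X ^ k + pol k y : F[X]).degree < ((k + 1 : ℕ) : WithBot ℕ) := by
    intro c y
    refine (degree_add_le _ _).trans_lt (max_lt ?_ ?_)
    · exact (degree_C_mul_X_pow_le k c).trans_lt (by norm_cast; omega)
    · exact (degree_pol_lt k y).trans (by norm_cast; omega)
  have hdeg' : ∀ (c : F) (y : Fin k → F), (C c * X ^ k + pol k y : F[X]).degree <
      (g.natDegree : WithBot ℕ) :=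
    fun c y => (hdeg c y).trans_le (by exact_mod_cast hk)
  rw [← Finset.sum_filter, ← Fintype.sum_prod_type']
  symm
  refine Finset.sum_bij' (fun z _ => AdjoinRoot.mk g (C z.1 * X ^ k + pol k z.2))
    (fun a _ => ((AdjoinRoot.modByMonicHom hg a).coeff k,
      fun i : Fin k => (AdjoinRoot.modByMonicHom hg a).coeff i)) ?_ ?_ ?_ ?_ ?_
  · rintro ⟨c, y⟩ _
    simp only [Finset.mem_filter, Finset.mem_univ, true_and]
    rw [red_mk hg (hdeg' c y)]
    exact hdeg c y
  · simp
  · rintro ⟨c, y⟩ _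
    simp only
    rw [red_mk hg (hdeg' c y)]
    ext i
    · simp [coeff_pol_self]
    · simp only [coeff_add, coeff_pol, coeff_C_mul, coeff_X_pow]
      have := i.2
      simp [this.ne]
  · intro a ha
    simp only [Finset.mem_filter, Finset.mem_univ, true_and] at ha
    conv_rhs => rw [← mk_red hg a]
    congr 1
    have h1 : (AdjoinRoot.modByMonicHom hg a).natDegree < k + 1 := by
      by_cases h0 : AdjoinRoot.modByMonicHom hg a = 0
      · simp [h0]
      · exact (natDegree_lt_iff_degree_lt h0).2 ha
    conv_rhs => rw [as_sum_range_C_mul_X_pow' _ h1, Finset.sum_range_succ, add_comm]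
    congr 1
    rw [pol, Fin.sum_univ_eq_sum_range
      (fun i => C ((AdjoinRoot.modByMonicHom hg a).coeff i) * X ^ i)]
  · simp

lemma key_sum [Fintype F] [Fintype (AdjoinRoot g)] (hg : g.Monic) (d k : ℕ)
    (hn : d + k + 1 = g.natDegree) (ψ : AddChar F ℂ) (hψ : ψ ≠ 1) (H : AdjoinRoot g → ℂ) :
    ∑ a, H a * ∑ c : Fin d → F, ψ (lam hg (a * AdjoinRoot.mk g (pol d c)))
      = (Fintype.card F : ℂ) ^ d *
        ∑ c : F, ∑ y : Fin k → F, H (AdjoinRoot.mk g (C c * X ^ k + pol k y)) := by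
  rw [← sum_trunc hg k (by omega) H, Finset.mul_sum]
  refine Finset.sum_congr rfl fun a _ => ?_
  simp only [lam_pol]
  rw [sum_psi_pi ψ hψ]
  simp only [lam_shift hg a d k hn]
  split_ifs
  · ring
  · simp

lemma sq_coeff (hg : g.Monic) (m : ℕ) (hn : m + m + 1 = g.natDegree) (P : F[X])
    (hP : P.natDegree ≤ m) : lam hg (AdjoinRoot.mk g P ^ 2) = P.coeff m ^ 2 := by
  rw [← map_pow, lam_mk]
  · rw [show g.natDegree - 1 = 2 * m by omega, coeff_pow_of_natDegree_le hP]
  · refine (degree_le_natDegree).trans_lt ?_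
    have := natDegree_pow_le (p := P) (n := 2)
    norm_cast
    omega

lemma sum_sq_A [Fintype F] [Fintype (AdjoinRoot g)] (h2 : (2 : F) ≠ 0) (hg : g.Monic) (m : ℕ)
    (hn : m + m + 1 = g.natDegree) (ψ : AddChar F ℂ) (hψ : ψ ≠ 1) :
    ∑ a, ψ (lam hg (a ^ 2)) = (Fintype.card F : ℂ) ^ m * ∑ c : F, ψ (c ^ 2) := by
  have hq : (Fintype.card F : ℂ) ^ m ≠ 0 := pow_ne_zero _ (by exact_mod_cast Fintype.card_ne_zero)
  apply mul_left_cancel₀ hq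
  have hψ2 : ψ.mulShift 2 ≠ 1 := AddChar.IsPrimitive.of_ne_one hψ h2
  have hpol : ∀ y : Fin m → F, (pol m y).natDegree ≤ m := fun y =>
    natDegree_le_of_degree_le (degree_pol_lt m y).le
  have h1 : ∀ (y : Fin m → F), ∑ a, ψ (lam hg (a ^ 2))
      = ∑ a, ψ (lam hg (a ^ 2)) * ψ.mulShift 2 (lam hg (a * AdjoinRoot.mk g (pol m y))) := by
    intro y
    rw [← Equiv.sum_comp (Equiv.addRight (AdjoinRoot.mk g (pol m y)))]
    refine Finset.sum_congr rfl fun a _ => ?_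
    rw [AddChar.mulShift_apply, ← AddChar.map_add_eq_mul]
    congr 1
    rw [Equiv.coe_addRight, add_sq, map_add, map_add, sq_coeff hg m hn _ (hpol y), coeff_pol_self]
    rw [show (2 : AdjoinRoot g) * a * AdjoinRoot.mk g (pol m y)
      = (2 : F) • (a * AdjoinRoot.mk g (pol m y)) by
        rw [Algebra.smul_def, map_ofNat, mul_assoc], map_smul, smul_eq_mul]
    ring
  have h3 : (Fintype.card F : ℂ) ^ m * ∑ a, ψ (lam hg (a ^ 2))
      = ∑ y : Fin m → F, ∑ a, ψ (lam hg (a ^ 2)) := by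
    simp
  rw [h3, Finset.sum_congr rfl fun y _ => h1 y, Finset.sum_comm]
  simp only [← Finset.mul_sum]
  rw [key_sum hg m m hn (ψ.mulShift 2) hψ2 (fun a => ψ (lam hg (a ^ 2)))]
  congr 1
  rw [Finset.mul_sum]
  refine Finset.sum_congr rfl fun c _ => ?_
  have h4 : ∀ y : Fin m → F, lam hg (AdjoinRoot.mk g (C c * X ^ m + pol m y) ^ 2) = c ^ 2 := by
    intro y
    rw [sq_coeff hg m hn]
    · simp [coeff_pol_self]
    · exact (natDegree_add_le _ _).trans (max_le (natDegree_C_mul_X_pow_le _ _) (hpol y))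
  simp only [h4]
  simp

lemma T_scale [Fintype F] (χ : AdjoinRoot g → ℂ)
    (hχ : ∀ (u : F) a, χ (u • a) = etaC F u * χ a) (k : ℕ) (u : F) (hu : u ≠ 0) (c : F) :
    ∑ y : Fin k → F, χ (AdjoinRoot.mk g (C (u * c) * X ^ k + pol k y))
      = etaC F u * ∑ y : Fin k → F, χ (AdjoinRoot.mk g (C c * X ^ k + pol k y)) := by
  rw [Finset.mul_sum]
  symm
  refine Finset.sum_bij' (fun y _ => u • y) (fun y _ => u⁻¹ • y) (by simp) (by simp) ?_ ?_ ?_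
  · intro y _; simp [smul_smul, hu]
  · intro y _; simp [smul_smul, hu]
  · intro y _
    rw [← hχ, AdjoinRoot.smul_mk]
    congr 2
    simp only [pol, smul_add, smul_eq_C_mul, Finset.mul_sum, Pi.smul_apply, smul_eq_mul, C_mul,
      mul_assoc]

lemma T_eq [Fintype F] (hF : ringChar F ≠ 2) (χ : AdjoinRoot g → ℂ)
    (hχ : ∀ (u : F) a, χ (u • a) = etaC F u * χ a) (k : ℕ) (c : F) :
    ∑ y : Fin k → F, χ (AdjoinRoot.mk g (C c * X ^ k + pol k y))
      = etaC F c * ∑ y : Fin k → F, χ (AdjoinRoot.mk g (monicOf k y)) := by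
  by_cases hc : c = 0
  · subst hc
    obtain ⟨u, hu⟩ := quadraticChar_exists_neg_one hF
    have hu0 : u ≠ 0 := by rintro rfl; simp at hu
    have := T_scale χ hχ k u hu0 0
    rw [mul_zero, etaC_apply, hu] at this
    rw [(etaC F).map_zero, zero_mul]
    push_cast at this
    linear_combination this / 2
  · have := T_scale χ hχ k c hc 1
    rw [mul_one] at this
    rw [this]
    simp [monicOf, pol]

lemma main_A [Fintype F] [Fintype (AdjoinRoot g)] (hF : ringChar F ≠ 2) (hg : g.Monic) (m : ℕ)
    (hn : m + m + 1 = g.natDegree) (ψ : AddChar F ℂ) (hψ : ψ ≠ 1) (χ : AdjoinRoot g → ℂ)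
    (hχ : ∀ (u : F) a, χ (u • a) = etaC F u * χ a)
    (hG : ∀ b, ∑ a, χ a * ψ (lam hg (a * b)) = χ b * ∑ a, ψ (lam hg (a ^ 2)))
    (d k : ℕ) (hdk : d + k + 1 = g.natDegree) :
    (Fintype.card F : ℂ) ^ m * ∑ c : Fin d → F, χ (AdjoinRoot.mk g (monicOf d c))
      = (Fintype.card F : ℂ) ^ d * ∑ c : Fin k → F, χ (AdjoinRoot.mk g (monicOf k c)) := by
  have h2 : (2 : F) ≠ 0 := Ring.two_ne_zero hF
  have hτ := sum_sq_ne_zero hF ψ hψ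
  apply mul_right_cancel₀ hτ
  have hS := sum_sq_A h2 hg m hn ψ hψ
  have h1 : (Fintype.card F : ℂ) ^ m * (∑ c : Fin d → F, χ (AdjoinRoot.mk g (monicOf d c)))
      * ∑ x : F, ψ (x ^ 2)
      = ∑ c : Fin d → F, χ (AdjoinRoot.mk g (monicOf d c)) * ∑ a, ψ (lam hg (a ^ 2)) := by
    rw [hS, ← Finset.sum_mul]; ring
  rw [h1]
  simp only [← hG]
  rw [Finset.sum_comm]
  have h3 : ∀ a : AdjoinRoot g,
      ∑ c : Fin d → F, χ a * ψ (lam hg (a * AdjoinRoot.mk g (monicOf d c)))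
      = (χ a * ψ (lam hg (a * AdjoinRoot.mk g (X ^ d)))) *
        ∑ c : Fin d → F, ψ (lam hg (a * AdjoinRoot.mk g (pol d c))) := by
    intro a
    rw [Finset.mul_sum]
    refine Finset.sum_congr rfl fun c _ => ?_
    rw [mul_assoc, ← AddChar.map_add_eq_mul, ← map_add, ← mul_add, ← map_add]
    rfl
  rw [Finset.sum_congr rfl fun a _ => h3 a, key_sum hg d k hdk ψ hψ
    (fun a => χ a * ψ (lam hg (a * AdjoinRoot.mk g (X ^ d)))), mul_assoc]
  congr 1
  rw [sum_sq hF ψ hψ, Finset.mul_sum]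
  refine Finset.sum_congr rfl fun c _ => ?_
  have h4 : ∀ y : Fin k → F,
      lam hg (AdjoinRoot.mk g (C c * X ^ k + pol k y) * AdjoinRoot.mk g (X ^ d)) = c := by
    intro y
    rw [← map_mul, lam_mk]
    · rw [show g.natDegree - 1 = k + d by omega, coeff_mul_X_pow]
      simp [coeff_pol_self]
    · have h5 : (C c * X ^ k + pol k y).natDegree ≤ k :=
        (natDegree_add_le _ _).trans (max_le (natDegree_C_mul_X_pow_le _ _)
          (natDegree_le_of_degree_le (degree_pol_lt k y).le))
      refine degree_le_natDegree.trans_lt ?_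
      have h6 := natDegree_mul_le (p := C c * X ^ k + pol k y) (q := X ^ d)
      rw [natDegree_X_pow] at h6
      norm_cast
      omega
  simp only [h4]
  rw [← Finset.sum_mul, T_eq hF χ hχ]
  ring

end
lemma pow_half {F : Type} [Field F] [Fintype F] (hodd : Fintype.card F % 2 = 1) (u : F) (k : ℕ) :
    u ^ (Fintype.card F ^ k / 2) = (u ^ (Fintype.card F / 2)) ^ k := by
  induction k with
  | zero => simp
  | succ k ih =>
    have h1 : Fintype.card F ^ k % 2 = 1 := by rw [Nat.pow_mod, hodd]; simp
    have h2 : Fintype.card F ^ (k + 1) / 2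
        = Fintype.card F * (Fintype.card F ^ k / 2) + Fintype.card F / 2 := by
      have h3 := Nat.div_add_mod (Fintype.card F ^ k) 2
      have h4 : Fintype.card F ^ (k + 1)
          = 2 * (Fintype.card F * (Fintype.card F ^ k / 2)) + Fintype.card F := by
        rw [pow_succ]
        conv_lhs => rw [← h3, h1]
        ring
      omega
    rw [h2, pow_add, pow_mul, FiniteField.pow_card, ih, pow_succ]

lemma quadraticChar_of {F : Type} [Field F] [Fintype F] (hF : ringChar F ≠ 2) (p : F[X])
    [Fact (Irreducible p)] [Fintype (AdjoinRoot p)] (u : F) :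
    quadraticChar (AdjoinRoot p) (AdjoinRoot.of p u) = quadraticChar F u ^ p.natDegree := by
  have hp : Irreducible p := Fact.out
  have hK : ringChar (AdjoinRoot p) ≠ 2 := by
    rwa [← Algebra.ringChar_eq F (AdjoinRoot p)]
  have hodd : Fintype.card F % 2 = 1 := FiniteField.odd_card_of_char_ne_two hF
  by_cases hu : u = 0
  · subst hu
    have : p.natDegree ≠ 0 := hp.natDegree_pos.ne'
    simp [this]
  have hcard : Fintype.card (AdjoinRoot p) = Fintype.card F ^ p.natDegree := by
    rw [Module.card_eq_pow_finrank (K := F)]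
    congr 1
    exact finrank_quotient_span_eq_natDegree
  have h1 := quadraticChar_eq_pow_of_char_ne_two' hK (AdjoinRoot.of p u)
  rw [hcard, ← map_pow, pow_half hodd, ← quadraticChar_eq_pow_of_char_ne_two' hF] at h1
  have h2 : ((quadraticChar (AdjoinRoot p) (AdjoinRoot.of p u) : ℤ) : AdjoinRoot p)
      = ((quadraticChar F u ^ p.natDegree : ℤ) : AdjoinRoot p) := by
    rw [h1]; simp
  refine Int.cast_injOn_of_ringChar_ne_two hK ?_ ?_ h2
  · have hu' : AdjoinRoot.of p u ≠ 0 := by simpa using hu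
    rcases quadraticChar_dichotomy hu' with h | h <;> rw [h] <;> simp
  · rcases quadraticChar_dichotomy hu with h | h <;> rw [h]
    · simp
    · rcases neg_one_pow_eq_or ℤ p.natDegree with h' | h' <;> rw [h'] <;> simp

lemma legendrePoly_eq {F : Type} [Field F] (p : F[X])
    [Fact (Irreducible p)] [Fintype (AdjoinRoot p)] (f : F[X]) :
    legendrePoly f p = quadraticChar (AdjoinRoot p) (AdjoinRoot.mk p f) := by
  have h1 : p ∣ f ↔ AdjoinRoot.mk p f = 0 := AdjoinRoot.mk_eq_zero.symm
  have h2 : (∃ h : F[X], p ∣ (h ^ 2 - f)) ↔ IsSquare (AdjoinRoot.mk p f) := by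
    constructor
    · rintro ⟨h, hh⟩
      rw [← AdjoinRoot.mk_eq_zero, map_sub, sub_eq_zero, map_pow] at hh
      exact ⟨AdjoinRoot.mk p h, by rw [← hh, sq]⟩
    · rintro ⟨r, hr⟩
      obtain ⟨h, rfl⟩ := AdjoinRoot.mk_surjective r
      refine ⟨h, ?_⟩
      rw [← AdjoinRoot.mk_eq_zero, map_sub, sub_eq_zero, map_pow, hr, sq]
  rw [quadraticChar_apply, quadraticCharFun, legendrePoly]
  simp only [h1, h2]

section
variable {F : Type} [Field F] {g : F[X]} {ι : Type} [Fintype ι] (p : ι → F[X])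

lemma crt (hp : ∏ i, p i = g) (hcop : ∀ i j, i ≠ j → IsCoprime (p i) (p j)) :
    ∃ e : AdjoinRoot g ≃+* (∀ i, AdjoinRoot (p i)),
      ∀ f i, e (AdjoinRoot.mk g f) i = AdjoinRoot.mk (p i) f := by
  have h1 : Ideal.span {g} = ⨅ i, Ideal.span {p i} := by
    rw [Ideal.iInf_span_singleton hcop, hp]
  have h2 : Pairwise (Function.onFun IsCoprime fun i => Ideal.span {p i}) := by
    intro i j hij
    exact (Ideal.isCoprime_span_singleton_iff _ _).2 (hcop i j hij)
  exact ⟨(Ideal.quotEquivOfEq h1).trans (Ideal.quotientInfRingEquivPiQuotient _ h2),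
    fun f i => rfl⟩

lemma main_chi [Fintype F] (hF : ringChar F ≠ 2) (hg : g.Monic)
    [Fintype (AdjoinRoot g)] [∀ i, Fact (Irreducible (p i))] [∀ i, Fintype (AdjoinRoot (p i))]
    (e : AdjoinRoot g ≃+* (∀ i, AdjoinRoot (p i)))
    (ψ : AddChar F ℂ) (hψ : ψ ≠ 1) (b : AdjoinRoot g) :
    ∑ a, (∏ i, etaC (AdjoinRoot (p i)) (e a i)) * ψ (lam hg (a * b))
      = (∏ i, etaC (AdjoinRoot (p i)) (e b i)) * ∑ a, ψ (lam hg (a ^ 2)) := by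
  set Ψ : AddChar (∀ i, AdjoinRoot (p i)) ℂ :=
    ψ.compAddMonoidHom ((lam hg).toAddMonoidHom.comp e.symm.toAddEquiv.toAddMonoidHom) with hΨ
  have hΨa : ∀ x, Ψ x = ψ (lam hg (e.symm x)) := fun x => rfl
  have hK : ∀ i, ringChar (AdjoinRoot (p i)) ≠ 2 := fun i => by
    rwa [← Algebra.ringChar_eq F (AdjoinRoot (p i))]
  have hne : ∀ i, ∃ x, Ψ (Pi.single i x) ≠ 1 := by
    intro i
    set a := e.symm (Pi.single i 1) with ha
    have ha0 : a ≠ 0 := by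
      intro h
      rw [ha, map_eq_zero_iff _ e.symm.injective] at h
      have := congrFun h i
      simp at this
    have hr : AdjoinRoot.modByMonicHom hg a ≠ 0 := by
      intro h
      apply ha0
      rw [← mk_red hg a, h, map_zero]
    have hv := lam_shift_ne hg a hr
    set w := AdjoinRoot.mk g
      (X ^ (g.natDegree - 1 - (AdjoinRoot.modByMonicHom hg a).natDegree)) with hw
    obtain ⟨u, hu⟩ : ∃ u, ψ u ≠ 1 := by
      by_contra! h
      exact hψ (by ext u; exact h u)
    set z := (u * (lam hg (a * w))⁻¹) • w with hz
    refine ⟨e z i, ?_⟩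
    have h1 : (Pi.single i (e z i) : ∀ i, AdjoinRoot (p i)) = Pi.single i 1 * e z := by
      ext j
      by_cases hj : j = i
      · subst hj; simp
      · simp [hj]
    rw [hΨa, h1, map_mul, ← ha, RingEquiv.symm_apply_apply, hz, mul_smul_comm, map_smul,
      smul_eq_mul, inv_mul_cancel_right₀ hv]
    exact hu
  have h := pi_gauss hK Ψ hne (e b)
  have h1 : ∑ a, ψ (lam hg (a ^ 2)) = ∑ a : ∀ i, AdjoinRoot (p i), Ψ (a ^ 2) := by
    rw [← Equiv.sum_comp e.toEquiv]
    refine Finset.sum_congr rfl fun a _ => ?_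
    rw [hΨa]
    simp
  rw [h1, ← h, ← Equiv.sum_comp e.toEquiv]
  refine Finset.sum_congr rfl fun a _ => ?_
  rw [hΨa]
  simp

lemma chi_smul [Fintype F] (hF : ringChar F ≠ 2) (hodd : Odd g.natDegree)
    (hp : ∏ i, p i = g)
    [∀ i, Fact (Irreducible (p i))] [∀ i, Fintype (AdjoinRoot (p i))]
    (e : AdjoinRoot g ≃+* (∀ i, AdjoinRoot (p i)))
    (he : ∀ f i, e (AdjoinRoot.mk g f) i = AdjoinRoot.mk (p i) f) (u : F) (a : AdjoinRoot g) :
    (∏ i, etaC (AdjoinRoot (p i)) (e (u • a) i))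
      = etaC F u * ∏ i, etaC (AdjoinRoot (p i)) (e a i) := by
  have h1 : ∀ i, e (u • a) i = AdjoinRoot.of (p i) u * e a i := by
    intro i
    rw [Algebra.smul_def, map_mul, Pi.mul_apply]
    congr 1
    exact he (C u) i
  have h2 : ∀ i, etaC (AdjoinRoot (p i)) (AdjoinRoot.of (p i) u)
      = etaC F u ^ (p i).natDegree := by
    intro i
    rw [etaC_apply, etaC_apply, quadraticChar_of hF, Int.cast_pow]
  simp only [h1, map_mul, h2, Finset.prod_mul_distrib]
  rw [Finset.prod_pow_eq_pow_sum, ← natDegree_prod _ _ fun i _ =>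
    (Fact.out : Irreducible (p i)).ne_zero, hp]
  congr 1
  obtain ⟨r, hr⟩ := hodd
  rw [hr]
  by_cases hu : u = 0
  · subst hu
    rw [(etaC F).map_zero]
    simp
  · have : etaC F u ^ 2 = 1 := by
      rw [etaC_apply, ← Int.cast_pow, quadraticChar_sq_one hu, Int.cast_one]
    rw [pow_succ, pow_mul, this, one_pow, one_mul]

lemma finite_adjoin [Fintype F] (hg : g ≠ 0) : Finite (AdjoinRoot g) := by
  have : Module.Finite F (AdjoinRoot g) := (AdjoinRoot.powerBasis hg).finite
  exact Module.finite_of_finite F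

end

lemma functional_eq (F : Type) [Field F] [Fintype F] (hF : ringChar F ≠ 2)
    (g : Polynomial F) (hg : g.Monic) (hsq : Squarefree g)
    (m : ℕ) (hn : m + m + 1 = g.natDegree) (d k : ℕ) (hdk : d + k + 1 = g.natDegree) :
    (Fintype.card F : ℂ) ^ m * (Lcoeff F g d : ℂ)
      = (Fintype.card F : ℂ) ^ d * (Lcoeff F g k : ℂ) := by
  set s := (UniqueFactorizationMonoid.normalizedFactors g) with hs
  have hnd : s.Nodup :=
    (UniqueFactorizationMonoid.squarefree_iff_nodup_normalizedFactors hg.ne_zero).1 hsq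
  have hval : s.toFinset.val = s := by rw [Multiset.toFinset_val, hnd.dedup]
  let ι : Type := {x // x ∈ s.toFinset}
  let p : ι → F[X] := fun i => i.1
  have hmem : ∀ i : ι, p i ∈ s := fun i => Multiset.mem_toFinset.1 i.2
  have hirr : ∀ i, Irreducible (p i) := fun i =>
    UniqueFactorizationMonoid.irreducible_of_normalized_factor _ (hmem i)
  have hprod : ∏ i, p i = g := by
    have h1 : ∏ i : ι, p i = ∏ x ∈ s.toFinset, x := Finset.prod_coe_sort s.toFinset (fun x => x)
    rw [h1, Finset.prod_eq_multiset_prod, hval, Multiset.map_id',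
      UniqueFactorizationMonoid.prod_normalizedFactors_eq hg.ne_zero, hg.normalize_eq_self]
  have hcop : ∀ i j, i ≠ j → IsCoprime (p i) (p j) := by
    intro i j hij
    rw [(hirr i).coprime_iff_not_dvd]
    intro hdvd
    have hass : Associated (p i) (p j) := (hirr i).associated_of_dvd (hirr j) hdvd
    apply hij
    apply Subtype.ext
    have hi := UniqueFactorizationMonoid.normalize_normalized_factor _ (hmem i)
    have hj := UniqueFactorizationMonoid.normalize_normalized_factor _ (hmem j)
    change p i = p j
    rw [← hi, ← hj]
    exact normalize_eq_normalize_iff_associated.2 hass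
  haveI : ∀ i, Fact (Irreducible (p i)) := fun i => ⟨hirr i⟩
  haveI := fun i => finite_adjoin (hirr i).ne_zero
  haveI := finite_adjoin hg.ne_zero
  letI : ∀ i, Fintype (AdjoinRoot (p i)) := fun i => Fintype.ofFinite _
  letI : Fintype (AdjoinRoot g) := Fintype.ofFinite _
  obtain ⟨e, he⟩ := crt p hprod hcop
  obtain ⟨ψ, hψ⟩ : ∃ ψ : AddChar F ℂ, ψ ≠ 1 := by
    refine ⟨AddChar.FiniteField.primitiveChar_to_Complex F, ?_⟩
    have := AddChar.FiniteField.primitiveChar_to_Complex_isPrimitive F (one_ne_zero (α := F))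
    rwa [AddChar.mulShift_one] at this
  have hres : ∀ f, ((resSym f g : ℤ) : ℂ)
      = ∏ i, etaC (AdjoinRoot (p i)) (e (AdjoinRoot.mk g f) i) := by
    intro f
    have h1 : resSym f g = ∏ i, legendrePoly f (p i) := by
      have h2 : ∏ i : ι, legendrePoly f (p i) = ∏ x ∈ s.toFinset, legendrePoly f x :=
        Finset.prod_coe_sort s.toFinset (fun x => legendrePoly f x)
      rw [h2, Finset.prod_eq_multiset_prod, hval]
      rfl
    rw [h1, Int.cast_prod]
    refine Finset.prod_congr rfl fun i _ => ?_
    rw [he, etaC_apply, legendrePoly_eq]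
  have hL : ∀ d, (Lcoeff F g d : ℂ) = ∑ c : Fin d → F,
      ∏ i, etaC (AdjoinRoot (p i)) (e (AdjoinRoot.mk g (monicOf d c)) i) := by
    intro d
    rw [Lcoeff, Int.cast_sum]
    exact Finset.sum_congr rfl fun c _ => hres _
  rw [hL, hL]
  exact main_A hF hg m hn ψ hψ (fun a => ∏ i, etaC (AdjoinRoot (p i)) (e a i))
    (chi_smul p hF ⟨m, by omega⟩ hprod e he) (main_chi p hF hg e ψ hψ) d k hdk

/-- Functional equation of the quadratic L-function for odd conductor degree, in coefficient
form: if `g` is monic squarefree of odd degree and `L(x,χ_g) = Σ_d c_d x^d`, then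
`c_{deg g - 1 - d} = q^{(deg g - 1)/2 - d} · c_d` for all `0 ≤ d ≤ deg g - 1`. -/
theorem stmt_6 (F : Type) [Field F] [Fintype F] (q : ℕ) (hF : Fintype.card F = q)
    (hq : q % 4 = 1) (g : Polynomial F) (hg : g.Monic) (hsq : Squarefree g)
    (hodd : Odd g.natDegree) (d : ℕ) (hd : d ≤ g.natDegree - 1) :
    (Lcoeff F g (g.natDegree - 1 - d) : ℚ)
      = (q : ℚ) ^ ((((g.natDegree - 1) / 2 : ℕ) : ℤ) - (d : ℤ)) * (Lcoeff F g d : ℚ) := by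
  subst hF
  have hF2 : ringChar F ≠ 2 := by
    intro h
    have := FiniteField.even_card_iff_char_two.1 h
    omega
  obtain ⟨m, hm⟩ := hodd
  have h := functional_eq F hF2 g hg hsq m (by omega) d (g.natDegree - 1 - d) (by omega)
  have h' : (Fintype.card F : ℚ) ^ m * (Lcoeff F g d : ℚ)
      = (Fintype.card F : ℚ) ^ d * (Lcoeff F g (g.natDegree - 1 - d) : ℚ) := by
    exact_mod_cast h
  have hq0 : (Fintype.card F : ℚ) ≠ 0 := by exact_mod_cast Fintype.card_ne_zero
  rw [show (g.natDegree - 1) / 2 = m by omega, zpow_sub₀ hq0, zpow_natCast, zpow_natCast,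
    div_mul_eq_mul_div, h', mul_div_cancel_left₀ _ (pow_ne_zero d hq0)]
end

section
/- Every element of the affine Weyl group of type Ã_n (n ≥ 2), presented by generators σ_0, ..., σ_n with relations σ_i² = 1, σ_i σ_{i+1} σ_i = σ_{i+1} σ_i σ_{i+1} (indices mod n+1), and σ_i σ_j = σ_j σ_i for j ≢ i ± 1, acts on C^(n+1) by the transformations (σ_i(x_0,...,x_n))_j = 1/(q x_i) if j ≡ i, = q^(1/2) x_i x_j if j ≡ i ± 1 mod n+1, and = x_j otherwise; these transformations satisfy all the defining relations, i.e., this assignment extends to a group action. -/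
/-- The transformation `σ_i` on `ℂ^{n+1}` (indices mod `n+1`):
`x_i ↦ 1/(q x_i)`, `x_j ↦ q^{1/2} x_i x_j` for `j ≡ i ± 1`, and `x_j ↦ x_j` otherwise. -/
noncomputable def affSigma (n : ℕ) (q : ℝ) (i : ZMod (n + 1)) (x : ZMod (n + 1) → ℂ) :
    ZMod (n + 1) → ℂ := fun j =>
  if j = i then 1 / ((q : ℂ) * x i)
  else if j = i + 1 ∨ j = i - 1 then (Real.sqrt q : ℂ) * x i * x j
  else x j

theorem affSigma_self (n : ℕ) (q : ℝ) (i : ZMod (n + 1)) (x : ZMod (n + 1) → ℂ) :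
    affSigma n q i x i = 1 / ((q : ℂ) * x i) := by simp [affSigma]

theorem affSigma_adj (n : ℕ) (q : ℝ) (i j : ZMod (n + 1)) (x : ZMod (n + 1) → ℂ)
    (h : j ≠ i) (hadj : j = i + 1 ∨ j = i - 1) :
    affSigma n q i x j = (Real.sqrt q : ℂ) * x i * x j := by
  simp only [affSigma, if_neg h, if_pos hadj]

theorem affSigma_off (n : ℕ) (q : ℝ) (i j : ZMod (n + 1)) (x : ZMod (n + 1) → ℂ)
    (h : j ≠ i) (hadj : ¬ (j = i + 1 ∨ j = i - 1)) :
    affSigma n q i x j = x j := by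
  simp only [affSigma, if_neg h, if_neg hadj]

/-- The transformations `σ_0, …, σ_n` satisfy the defining relations of the affine Weyl
group of type `Ã_n` (`n ≥ 2`): `σ_i² = 1`, the braid relations
`σ_i σ_{i+1} σ_i = σ_{i+1} σ_i σ_{i+1}` (indices mod `n+1`), and commutation
`σ_i σ_j = σ_j σ_i` for `j ≢ i ± 1`; hence the assignment extends to a group action. -/
theorem stmt_7 (n : ℕ) (hn : 2 ≤ n) (q : ℝ) (hq : 0 < q)
    (x : ZMod (n + 1) → ℂ) (hx : ∀ j, x j ≠ 0) :
    (∀ i, affSigma n q i (affSigma n q i x) = x) ∧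
    (∀ i, affSigma n q i (affSigma n q (i + 1) (affSigma n q i x))
        = affSigma n q (i + 1) (affSigma n q i (affSigma n q (i + 1) x))) ∧
    (∀ i j, j ≠ i → j ≠ i + 1 → j ≠ i - 1 →
        affSigma n q i (affSigma n q j x) = affSigma n q j (affSigma n q i x)) := by
  have h1 : (1 : ZMod (n + 1)) ≠ 0 := by
    have : Fact (1 < n + 1) := ⟨by omega⟩
    exact one_ne_zero
  have hs0 : (Real.sqrt q : ℂ) ≠ 0 := by
    exact_mod_cast ne_of_gt (Real.sqrt_pos.mpr hq)
  have hsq : (q : ℂ) = (Real.sqrt q : ℂ) ^ 2 := by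
    exact_mod_cast (Real.sq_sqrt hq.le).symm
  refine ⟨fun i => ?_, fun i => ?_, fun i j hij hij1 hij2 => ?_⟩
  · funext k
    have hi := hx i
    by_cases hk : k = i
    · subst hk
      rw [affSigma_self, affSigma_self, hsq]
      field_simp
    · by_cases ha : k = i + 1 ∨ k = i - 1
      · rw [affSigma_adj _ _ _ _ _ hk ha, affSigma_adj _ _ _ _ _ hk ha, affSigma_self, hsq]
        field_simp
      · rw [affSigma_off _ _ _ _ _ hk ha, affSigma_off _ _ _ _ _ hk ha]
  · have hi := hx i
    have hi1 := hx (i + 1)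
    have n1 : i + 1 ≠ i := by simpa using h1
    have n2 : i ≠ i + 1 := n1.symm
    have a1 : i + 1 = i + 1 ∨ i + 1 = i - 1 := Or.inl rfl
    have a2 : i = i + 1 + 1 ∨ i = i + 1 - 1 := Or.inr (by ring)
    have e1 := fun y => affSigma_adj n q i (i + 1) y n1 a1
    have e2 := fun y => affSigma_adj n q (i + 1) i y n2 a2
    funext k
    by_cases hk : k = i
    · subst hk
      simp only [affSigma_self, e1, e2, hsq]
      field_simp
    by_cases hk1 : k = i + 1
    · subst hk1
      simp only [affSigma_self, e1, e2, hsq]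
      field_simp
    by_cases ha : k = i + 1 ∨ k = i - 1 <;> by_cases hb : k = i + 1 + 1 ∨ k = i + 1 - 1
    · simp only [affSigma_self, e1, e2, affSigma_adj _ _ _ _ _ hk ha,
        affSigma_adj _ _ _ _ _ hk1 hb, hsq]
      field_simp
    · simp only [affSigma_self, e1, e2, affSigma_adj _ _ _ _ _ hk ha,
        affSigma_off _ _ _ _ _ hk1 hb, hsq]
      field_simp
    · simp only [affSigma_self, e1, e2, affSigma_off _ _ _ _ _ hk ha,
        affSigma_adj _ _ _ _ _ hk1 hb, hsq]
      field_simp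
    · simp only [affSigma_off _ _ _ _ _ hk ha, affSigma_off _ _ _ _ _ hk1 hb]
  · have a1 : ¬ (j = i + 1 ∨ j = i - 1) := by tauto
    have a2 : ¬ (i = j + 1 ∨ i = j - 1) := by
      rintro (h | h)
      · exact hij2 (by rw [h]; ring)
      · exact hij1 (by rw [h]; ring)
    have e1 := fun y => affSigma_off n q i j y hij a1
    have e2 := fun y => affSigma_off n q j i y hij.symm a2
    funext k
    by_cases hk : k = i
    · subst hk
      simp only [affSigma_self, e2]
    by_cases hk1 : k = j
    · subst hk1
      simp only [affSigma_self, e1]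
    by_cases ha : k = i + 1 ∨ k = i - 1 <;> by_cases hb : k = j + 1 ∨ k = j - 1
    · simp only [e1, e2, affSigma_adj _ _ _ _ _ hk ha, affSigma_adj _ _ _ _ _ hk1 hb]
      ring
    · simp only [e2, affSigma_adj _ _ _ _ _ hk ha, affSigma_off _ _ _ _ _ hk1 hb]
    · simp only [e1, affSigma_off _ _ _ _ _ hk ha, affSigma_adj _ _ _ _ _ hk1 hb]
    · simp only [affSigma_off _ _ _ _ _ hk ha, affSigma_off _ _ _ _ _ hk1 hb]
end
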